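/- For every congestion policy C there exists a doubly-substochastic matrix that is non-redundant and sgreedy; moreover, any two non-redundant sgreedy matrices are equal. -/

import Mathlib

open Finset

/-- `A` is a doubly-substochastic `M × T` matrix: boxes `1..M`, rounds `1..T`,
nonnegative entries, every row and every column sums to at most 1. -/
def Substochastic (M T : ℕ) (A : ℕ → ℕ → ℝ) : Prop :=
  (∀ x t, 0 ≤ A x t) ∧
  (∀ x ∈ Icc 1 M, ∑ t ∈ Icc 1 T, A x t ≤ 1) ∧
  (∀ t ∈ Icc 1 T, ∑ x ∈ Icc 1 M, A x t ≤ 1)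

/-- `N̄_A(x,t)`: the probability that `A` does not visit box `x` by (and including) round `t`. -/
def Nbar (A : ℕ → ℕ → ℝ) (x t : ℕ) : ℝ := 1 - ∑ s ∈ Icc 1 t, A x s

/-- `f` is a positive, nonincreasing probability distribution on boxes `1..M`. -/
def BoxDist (M : ℕ) (f : ℕ → ℝ) : Prop :=
  (∀ x ∈ Icc 1 M, 0 < f x) ∧
  (∀ x, 1 ≤ x → x + 1 ≤ M → f (x + 1) ≤ f x) ∧
  (∑ x ∈ Icc 1 M, f x = 1)

/-- `C` is a congestion policy for `k` players: nonnegative, nonincreasing on `1..k`,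
`C 1 = 1`, and `C ℓ < 1` for some `ℓ ≤ k`. -/
def Policy (k : ℕ) (C : ℕ → ℝ) : Prop :=
  (∀ ℓ, 1 ≤ ℓ → ℓ ≤ k → 0 ≤ C ℓ) ∧ (C 1 = 1) ∧
  (∀ ℓ ℓ', 1 ≤ ℓ → ℓ ≤ ℓ' → ℓ' ≤ k → C ℓ' ≤ C ℓ) ∧
  (∃ ℓ, 1 ≤ ℓ ∧ ℓ ≤ k ∧ C ℓ < 1)

/-- The value of box `x` at round `t` against `k-1` copies of `A`. -/
def val (k : ℕ) (C f : ℕ → ℝ) (A : ℕ → ℕ → ℝ) (x t : ℕ) : ℝ :=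
  f x * ∑ ℓ ∈ range k,
    C (ℓ + 1) * ((k - 1).choose ℓ : ℝ) * A x t ^ ℓ * Nbar A x t ^ (k - 1 - ℓ)

/-- The utility of `B` against `k-1` copies of `A`. -/
def util (M T k : ℕ) (C f : ℕ → ℝ) (A B : ℕ → ℕ → ℝ) : ℝ :=
  ∑ t ∈ Icc 1 T, ∑ x ∈ Icc 1 M, B x t * val k C f A x t

/-- `A` is non-redundant: each column `t ≤ min T M` sums to exactly 1. -/
def NonRedundant (M T : ℕ) (A : ℕ → ℕ → ℝ) : Prop :=
  ∀ t, 1 ≤ t → t ≤ min T M → ∑ x ∈ Icc 1 M, A x t = 1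

/-- `A` is self-greedy: for each round `t ≤ T` it is greedy at round `t` with respect to
`k-1` copies of itself. -/
def SGreedy (M T k : ℕ) (C f : ℕ → ℝ) (A : ℕ → ℕ → ℝ) : Prop :=
  ∀ t, 1 ≤ t → t ≤ T → ∀ B, Substochastic M T B →
    (∀ x s, s < t → B x s = A x s) →
    ∑ x ∈ Icc 1 M, B x t * val k C f A x t ≤ ∑ x ∈ Icc 1 M, A x t * val k C f A x t

/-- The expectation of `c` under the unnormalised binomial weights
`m.choose ℓ * p ^ ℓ * r ^ (m - ℓ)`. -/
def binomialSum (m : ℕ) (c : ℕ → ℝ) (p r : ℝ) : ℝ :=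
  ∑ ℓ ∈ range (m + 1), c ℓ * (m.choose ℓ : ℝ) * p ^ ℓ * r ^ (m - ℓ)

lemma binomialSum_succ (m : ℕ) (c : ℕ → ℝ) (p r : ℝ) :
    binomialSum (m + 1) c p r =
      p * binomialSum m (fun ℓ => c (ℓ + 1)) p r + r * binomialSum m c p r := by
  have h : r * binomialSum m c p r =
      ∑ ℓ ∈ range (m + 2), c ℓ * (m.choose ℓ : ℝ) * p ^ ℓ * r ^ (m + 1 - ℓ) := by
    rw [sum_range_succ, Nat.choose_succ_self, binomialSum, mul_sum]
    simp only [Nat.cast_zero, mul_zero, zero_mul, add_zero]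
    refine sum_congr rfl fun ℓ hℓ => ?_
    rw [Nat.sub_add_comm (Nat.lt_succ_iff.mp (mem_range.mp hℓ)), pow_succ]
    ring
  rw [h, sum_range_succ' _ (m + 1), binomialSum, binomialSum, sum_range_succ' _ (m + 1), mul_sum,
    ← add_assoc, ← sum_add_distrib]
  congr 1
  · refine sum_congr rfl fun ℓ _ => ?_
    rw [Nat.choose_succ_succ, Nat.succ_sub_succ]
    push_cast
    ring
  · simp

lemma binomialSum_nonneg {m : ℕ} {c : ℕ → ℝ} {p r : ℝ} (hc : ∀ ℓ ≤ m, 0 ≤ c ℓ)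
    (hp : 0 ≤ p) (hr : 0 ≤ r) : 0 ≤ binomialSum m c p r :=
  sum_nonneg fun ℓ hℓ => by
    have := hc ℓ (Nat.lt_succ_iff.mp (mem_range.mp hℓ))
    positivity

lemma binomialSum_pos {m : ℕ} {c : ℕ → ℝ} {p r : ℝ} (hc : ∀ ℓ ≤ m, 0 ≤ c ℓ)
    (hc' : ∃ ℓ ≤ m, 0 < c ℓ) (hp : 0 < p) (hr : 0 < r) : 0 < binomialSum m c p r := by
  obtain ⟨j, hj, hcj⟩ := hc'
  refine sum_pos' (fun ℓ hℓ => ?_) ⟨j, mem_range.mpr (Nat.lt_succ_of_le hj), ?_⟩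
  · have := hc ℓ (Nat.lt_succ_iff.mp (mem_range.mp hℓ))
    positivity
  · have : 0 < (m.choose j : ℝ) := by exact_mod_cast Nat.choose_pos hj
    positivity

lemma binomialSum_sub (m : ℕ) (c d : ℕ → ℝ) (p r : ℝ) :
    binomialSum m (fun ℓ => c ℓ - d ℓ) p r = binomialSum m c p r - binomialSum m d p r := by
  simp only [binomialSum, sub_mul, sum_sub_distrib]

lemma binomialSum_antitone {m : ℕ} {c : ℕ → ℝ} (hc : ∀ ℓ < m, c (ℓ + 1) ≤ c ℓ)
    {n p p' : ℝ} (hp : 0 ≤ p) (hpp' : p ≤ p') (hn : p' ≤ n) :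
    binomialSum m c p' (n - p') ≤ binomialSum m c p (n - p) := by
  induction m generalizing c with
  | zero => simp [binomialSum]
  | succ m ih =>
    have h₁ := ih (c := c) fun ℓ hℓ => hc ℓ (by lia)
    have h₂ := ih (c := fun ℓ => c (ℓ + 1)) fun ℓ hℓ => hc (ℓ + 1) (by lia)
    have h₃ : 0 ≤ binomialSum m (fun ℓ => c ℓ - c (ℓ + 1)) p (n - p) :=
      binomialSum_nonneg (fun ℓ hℓ => sub_nonneg.mpr (hc ℓ (by lia))) hp (by linarith)
    rw [binomialSum_sub] at h₃
    rw [binomialSum_succ, binomialSum_succ]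
    nlinarith [mul_le_mul_of_nonneg_left h₁ (sub_nonneg.mpr hn),
      mul_le_mul_of_nonneg_left h₂ (hp.trans hpp'), mul_nonneg (sub_nonneg.mpr hpp') h₃]

lemma binomialSum_strictAnti {m : ℕ} {c : ℕ → ℝ} (hc : ∀ ℓ < m, c (ℓ + 1) ≤ c ℓ)
    (hc' : ∃ ℓ < m, c (ℓ + 1) < c ℓ)
    {n p p' : ℝ} (hp : 0 ≤ p) (hpp' : p < p') (hn : p' ≤ n) :
    binomialSum m c p' (n - p') < binomialSum m c p (n - p) := by
  obtain ⟨j, hj, hcj⟩ := hc'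
  obtain ⟨m, rfl⟩ : ∃ i, m = i + 1 := ⟨m - 1, by lia⟩
  set u := (p + p') / 2 with hu
  refine lt_of_lt_of_le ?_ (binomialSum_antitone hc hp (by linarith : p ≤ u) (by linarith))
  have h₁ := binomialSum_antitone (m := m) (c := c) (fun ℓ hℓ => hc ℓ (by lia))
    (by linarith : 0 ≤ u) (by linarith : u ≤ p') hn
  have h₂ := binomialSum_antitone (m := m) (c := fun ℓ => c (ℓ + 1))
    (fun ℓ hℓ => hc (ℓ + 1) (by lia)) (by linarith : 0 ≤ u) (by linarith : u ≤ p') hn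
  have h₃ : 0 < binomialSum m (fun ℓ => c ℓ - c (ℓ + 1)) u (n - u) :=
    binomialSum_pos (fun ℓ hℓ => sub_nonneg.mpr (hc ℓ (by lia)))
      ⟨j, by lia, sub_pos.mpr hcj⟩ (by linarith) (by linarith)
  rw [binomialSum_sub] at h₃
  rw [binomialSum_succ, binomialSum_succ]
  nlinarith [mul_le_mul_of_nonneg_left h₁ (sub_nonneg.mpr hn),
    mul_le_mul_of_nonneg_left h₂ (hp.trans hpp'.le),
    mul_pos (by linarith : 0 < p' - u) h₃]

lemma Policy.succ_le {k : ℕ} {C : ℕ → ℝ} (hC : Policy k C) :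
    ∀ ℓ < k - 1, C (ℓ + 1 + 1) ≤ C (ℓ + 1) :=
  fun ℓ hℓ => hC.2.2.1 _ _ (by lia) (by lia) (by lia)

lemma Policy.exists_succ_lt {k : ℕ} {C : ℕ → ℝ} (hC : Policy k C) :
    ∃ ℓ < k - 1, C (ℓ + 1 + 1) < C (ℓ + 1) := by
  by_contra! h
  obtain ⟨-, h₁, -, j, hj, hjk, hCj⟩ := hC
  have key : ∀ ℓ, ℓ + 1 ≤ k → 1 ≤ C (ℓ + 1) := by
    intro ℓ
    induction ℓ with
    | zero => intro _; exact h₁.ge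
    | succ ℓ ih => intro hℓ; exact (ih (by lia)).trans (h ℓ (by lia))
  have := key (j - 1) (by lia)
  rw [Nat.sub_add_cancel hj] at this
  linarith

lemma Nbar_zero (A : ℕ → ℕ → ℝ) (x : ℕ) : Nbar A x 0 = 1 := by simp [Nbar]

lemma Nbar_succ (A : ℕ → ℕ → ℝ) (x t : ℕ) : Nbar A x (t + 1) = Nbar A x t - A x (t + 1) := by
  rw [Nbar, Nbar, sum_Icc_succ_top (by lia)]
  ring

lemma Nbar_congr {A B : ℕ → ℕ → ℝ} {x t : ℕ} (h : ∀ s ∈ Icc 1 t, A x s = B x s) :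
    Nbar A x t = Nbar B x t := by
  rw [Nbar, Nbar, sum_congr rfl h]

lemma val_congr {k : ℕ} {C f : ℕ → ℝ} {A B : ℕ → ℕ → ℝ} {x t : ℕ}
    (ht : 1 ≤ t) (h : ∀ s ∈ Icc 1 t, A x s = B x s) : val k C f A x t = val k C f B x t := by
  rw [_root_.val, _root_.val, Nbar_congr h, h t (by simp [ht])]

/-- The value of a box of prior weight `w` that is still unvisited with probability `n` and is
now visited with probability `p`. -/
def roundValue (k : ℕ) (C : ℕ → ℝ) (w n p : ℝ) : ℝ :=
  w * binomialSum (k - 1) (fun ℓ => C (ℓ + 1)) p (n - p)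

lemma val_succ {k : ℕ} (hk : 1 ≤ k) (C f : ℕ → ℝ) (A : ℕ → ℕ → ℝ) (x t : ℕ) :
    val k C f A x (t + 1) = roundValue k C (f x) (Nbar A x t) (A x (t + 1)) := by
  rw [_root_.val, roundValue, binomialSum, Nbar_succ, Nat.sub_add_cancel hk]

lemma continuous_roundValue (k : ℕ) (C : ℕ → ℝ) (w n : ℝ) : Continuous (roundValue k C w n) := by
  unfold roundValue binomialSum
  fun_prop

lemma roundValue_nonneg {k : ℕ} {C : ℕ → ℝ} (hk : 1 ≤ k) (hC : Policy k C) {w n p : ℝ}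
    (hw : 0 ≤ w) (hp : 0 ≤ p) (hpn : p ≤ n) : 0 ≤ roundValue k C w n p :=
  mul_nonneg hw (binomialSum_nonneg (fun ℓ _ => hC.1 _ (by lia) (by lia)) hp (by linarith))

lemma roundValue_strictAnti {k : ℕ} {C : ℕ → ℝ} (hC : Policy k C) {w n p p' : ℝ}
    (hw : 0 < w) (hp : 0 ≤ p) (hpp' : p < p') (hn : p' ≤ n) :
    roundValue k C w n p' < roundValue k C w n p :=
  mul_lt_mul_of_pos_left (binomialSum_strictAnti hC.succ_le hC.exists_succ_lt hp hpp' hn) hw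

/-- The column of `A` at round `t + 1` is a best response, among all columns compatible with the
first `t` rounds of `A`, to the values induced by `A`. -/
def RoundOptimal (M k : ℕ) (C f : ℕ → ℝ) (A : ℕ → ℕ → ℝ) (t : ℕ) : Prop :=
  ∀ q : ℕ → ℝ, (∀ x, 0 ≤ q x) → (∀ x ∈ Icc 1 M, q x ≤ Nbar A x t) → ∑ x ∈ Icc 1 M, q x ≤ 1 →
    ∑ x ∈ Icc 1 M, q x * val k C f A x (t + 1) ≤
      ∑ x ∈ Icc 1 M, A x (t + 1) * val k C f A x (t + 1)

lemma Substochastic.Nbar_nonneg {M T : ℕ} {A : ℕ → ℕ → ℝ} (hA : Substochastic M T A)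
    {x t : ℕ} (hx : x ∈ Icc 1 M) (ht : t ≤ T) : 0 ≤ Nbar A x t :=
  sub_nonneg.mpr <| (sum_le_sum_of_subset_of_nonneg (Icc_subset_Icc_right ht)
    fun s _ _ => hA.1 x s).trans (hA.2.1 x hx)

lemma sGreedy_of_roundOptimal {M T k : ℕ} {C f : ℕ → ℝ} {A : ℕ → ℕ → ℝ}
    (h : ∀ t < T, RoundOptimal M k C f A t) : SGreedy M T k C f A := by
  intro t ht htT B hB hBA
  obtain ⟨t, rfl⟩ : ∃ s, t = s + 1 := ⟨t - 1, by lia⟩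
  refine h t htT (fun x => B x (t + 1)) (fun x => hB.1 x _) (fun x hx => ?_)
    (hB.2.2 _ (by simp [htT]))
  have h₁ := hB.Nbar_nonneg hx htT
  rw [Nbar_succ, Nbar_congr (B := A) fun s hs => hBA x s (Nat.lt_succ_of_le (mem_Icc.mp hs).2)]
    at h₁
  exact sub_nonneg.mp h₁

lemma SGreedy.roundOptimal {M T k : ℕ} {C f : ℕ → ℝ} {A : ℕ → ℕ → ℝ}
    (hA : Substochastic M T A) (h : SGreedy M T k C f A) {t : ℕ} (ht : t < T) :
    RoundOptimal M k C f A t := by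
  intro q hq hqn hq1
  let B : ℕ → ℕ → ℝ := fun x s => if s ≤ t then A x s else if s = t + 1 then q x else 0
  have hBt : ∀ x, B x (t + 1) = q x := fun x => by simp [B]
  have hB : Substochastic M T B := by
    refine ⟨fun x s => ?_, fun x hx => ?_, fun s hs => ?_⟩
    · simp only [B]
      split_ifs
      exacts [hA.1 x s, hq x, le_rfl]
    · have h₀ : ∑ s ∈ Icc 1 (t + 1), B x s = ∑ s ∈ Icc 1 T, B x s := by
        refine sum_subset (Icc_subset_Icc_right ht) fun s hs hs' => ?_
        simp only [mem_Icc] at hs hs'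
        simp only [B]
        rw [if_neg (by lia), if_neg (by lia)]
      have h₁ : Nbar B x t = Nbar A x t :=
        Nbar_congr fun s hs => if_pos (mem_Icc.mp hs).2
      have h₂ : 0 ≤ Nbar B x (t + 1) := by
        rw [Nbar_succ, h₁, hBt]
        exact sub_nonneg.mpr (hqn x hx)
      rw [← h₀]
      exact sub_nonneg.mp h₂
    · rcases lt_trichotomy s (t + 1) with hst | rfl | hst
      · simpa only [B, if_pos (Nat.lt_succ_iff.mp hst)] using hA.2.2 s hs
      · simpa only [hBt] using hq1
      · simp only [B, if_neg (by lia : ¬ s ≤ t), if_neg (by lia : ¬ s = t + 1), sum_const_zero,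
          zero_le_one]
  have := h (t + 1) (by lia) ht B hB fun x s hs => if_pos (Nat.lt_succ_iff.mp hs)
  simpa only [hBt] using this

/-- Two columns that are best responses to their own values coincide, provided each value is
strictly decreasing in the mass put on its box. -/
lemma eq_of_mutual_bestResponse {ι : Type*} {s : Finset ι} {v : ι → ℝ → ℝ} {n q q' : ι → ℝ}
    (hv : ∀ x ∈ s, ∀ a b, 0 ≤ a → a < b → b ≤ n x → v x b < v x a)
    (hq : ∀ x ∈ s, 0 ≤ q x ∧ q x ≤ n x) (hq' : ∀ x ∈ s, 0 ≤ q' x ∧ q' x ≤ n x)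
    (h : ∑ x ∈ s, q' x * v x (q x) ≤ ∑ x ∈ s, q x * v x (q x))
    (h' : ∑ x ∈ s, q x * v x (q' x) ≤ ∑ x ∈ s, q' x * v x (q' x)) :
    ∀ x ∈ s, q x = q' x := by
  have hpos : ∀ x ∈ s, q x ≠ q' x → 0 < (q' x - q x) * (v x (q x) - v x (q' x)) := by
    intro x hx hne
    rcases lt_or_gt_of_ne hne with hlt | hlt
    · exact mul_pos (by linarith) (by linarith [hv x hx _ _ (hq x hx).1 hlt (hq' x hx).2])
    · exact mul_pos_of_neg_of_neg (by linarith)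
        (by linarith [hv x hx _ _ (hq' x hx).1 hlt (hq x hx).2])
  by_contra! hne
  obtain ⟨x, hx, hne⟩ := hne
  have hsum : 0 < ∑ x ∈ s, (q' x - q x) * (v x (q x) - v x (q' x)) := by
    refine sum_pos' (fun y hy => ?_) ⟨x, hx, hpos x hx hne⟩
    by_cases hy' : q y = q' y
    · simp [hy']
    · exact (hpos y hy hy').le
  have heq : ∑ x ∈ s, (q' x - q x) * (v x (q x) - v x (q' x)) =
      (∑ x ∈ s, q' x * v x (q x) - ∑ x ∈ s, q x * v x (q x)) +
      (∑ x ∈ s, q x * v x (q' x) - ∑ x ∈ s, q' x * v x (q' x)) := by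
    rw [← sum_sub_distrib, ← sum_sub_distrib, ← sum_add_distrib]
    exact sum_congr rfl fun x _ => by ring
  linarith

/-- A column of prescribed total mass that is a best response to its own values among columns of
the same mass: a maximiser of the potential `∑ x, ∫ u in 0..q x, v x u`. -/
lemma exists_bestResponse_of_sum_eq {ι : Type*} {s : Finset ι} {v : ι → ℝ → ℝ} {n : ι → ℝ}
    {w : ℝ} (hv : ∀ x, Continuous (v x)) (hne : ∃ q, 0 ≤ q ∧ q ≤ n ∧ ∑ x ∈ s, q x = w) :
    ∃ q : ι → ℝ, 0 ≤ q ∧ q ≤ n ∧ ∑ x ∈ s, q x = w ∧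
      ∀ p : ι → ℝ, 0 ≤ p → p ≤ n → ∑ x ∈ s, p x = w →
        ∑ x ∈ s, p x * v x (q x) ≤ ∑ x ∈ s, q x * v x (q x) := by
  let V : ι → ℝ → ℝ := fun x u => ∫ y in (0 : ℝ)..u, v x y
  have hV : ∀ x u, HasDerivAt (V x) (v x u) u := fun x u =>
    ((hv x).integral_hasStrictDerivAt 0 u).hasDerivAt
  have hVc : ∀ x, Continuous (V x) := fun x =>
    continuous_iff_continuousAt.mpr fun u => (hV x u).continuousAt
  let K : Set (ι → ℝ) := Set.Icc 0 n ∩ {q | ∑ x ∈ s, q x = w}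
  have hK : IsCompact K := isCompact_Icc.inter_right
    (isClosed_eq (continuous_finsetSum _ fun x _ => continuous_apply x) continuous_const)
  obtain ⟨q₀, h₀, h₀n, h₀w⟩ := hne
  obtain ⟨q, ⟨⟨hq0, hqn⟩, hqw⟩, hmax⟩ := hK.exists_isMaxOn ⟨q₀, ⟨h₀, h₀n⟩, h₀w⟩
    (f := fun q => ∑ x ∈ s, V x (q x))
    (continuous_finsetSum _ fun x _ => (hVc x).comp (continuous_apply x)).continuousOn
  refine ⟨q, hq0, hqn, hqw, fun p hp0 hpn hpw => ?_⟩
  let φ : ℝ → ℝ := fun ε => ∑ x ∈ s, V x (q x + ε * (p x - q x))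
  have hφ : HasDerivAt φ (∑ x ∈ s, v x (q x) * (p x - q x)) 0 := by
    refine HasDerivAt.fun_sum fun x _ => ?_
    have h₁ : HasDerivAt (fun ε : ℝ => q x + ε * (p x - q x)) (p x - q x) 0 := by
      simpa using ((hasDerivAt_id (0 : ℝ)).mul_const (p x - q x)).const_add (q x)
    exact HasDerivAt.comp (0 : ℝ) (by simpa using hV x (q x)) h₁
  have hφmax : IsMaxOn φ (Set.Icc 0 1) 0 := by
    intro ε hε
    have hmem : (fun x => q x + ε * (p x - q x)) ∈ K := by
      refine ⟨⟨fun x => ?_, fun x => ?_⟩, ?_⟩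
      · have := hq0 x; have := hp0 x
        simp only [Pi.zero_apply] at *
        nlinarith [hε.1, hε.2]
      · have := hqn x; have := hpn x
        nlinarith [hε.1, hε.2]
      · simp only [Set.mem_ofPred_eq, sum_add_distrib, ← mul_sum, sum_sub_distrib, hpw]
        rw [show ∑ x ∈ s, q x = w from hqw]
        ring
    simpa [φ] using hmax hmem
  have hle := hφmax.localize.hasFDerivWithinAt_nonpos hφ.hasFDerivAt.hasFDerivWithinAt
    (sub_mem_posTangentConeAt_of_segment_subset (y := (1 : ℝ)) (by simp [segment_eq_Icc]))
  have heq : ∑ x ∈ s, v x (q x) * (p x - q x) =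
      ∑ x ∈ s, p x * v x (q x) - ∑ x ∈ s, q x * v x (q x) := by
    rw [← sum_sub_distrib]
    exact sum_congr rfl fun x _ => by ring
  simp only [sub_zero, ContinuousLinearMap.toSpanSingleton_apply, one_smul] at hle
  linarith

/-- A column bounded by `n` can be raised, within the bound `n`, to any larger total mass. -/
lemma exists_ge_sum_eq {ι : Type*} {s : Finset ι} {n p : ι → ℝ} {w : ℝ} (hpn : p ≤ n)
    (hp : ∑ x ∈ s, p x ≤ w) (hw : w ≤ ∑ x ∈ s, n x) :
    ∃ p', p ≤ p' ∧ p' ≤ n ∧ ∑ x ∈ s, p' x = w := by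
  rcases (hp.trans hw).eq_or_lt with h | h
  · exact ⟨p, le_rfl, hpn, by linarith⟩
  · have hd : 0 < ∑ x ∈ s, n x - ∑ x ∈ s, p x := sub_pos.mpr h
    set r := (w - ∑ x ∈ s, p x) / (∑ x ∈ s, n x - ∑ x ∈ s, p x) with hr
    have hr0 : 0 ≤ r := div_nonneg (by linarith) hd.le
    have hr1 : r ≤ 1 := (div_le_one hd).mpr (by linarith)
    refine ⟨fun x => p x + r * (n x - p x), fun x => ?_, fun x => ?_, ?_⟩
    · have := hpn x
      nlinarith
    · have := hpn x
      nlinarith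
    · rw [sum_add_distrib, ← mul_sum, sum_sub_distrib, hr, div_mul_cancel₀ _ hd.ne']
      ring

lemma exists_bestResponse {ι : Type*} {s : Finset ι} {v : ι → ℝ → ℝ} {n : ι → ℝ}
    (hn : 0 ≤ n) (hv : ∀ x, Continuous (v x))
    (hv0 : ∀ x ∈ s, ∀ u, 0 ≤ u → u ≤ n x → 0 ≤ v x u) :
    ∃ q : ι → ℝ, 0 ≤ q ∧ q ≤ n ∧ ∑ x ∈ s, q x = min 1 (∑ x ∈ s, n x) ∧
      ∀ p : ι → ℝ, 0 ≤ p → p ≤ n → ∑ x ∈ s, p x ≤ 1 →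
        ∑ x ∈ s, p x * v x (q x) ≤ ∑ x ∈ s, q x * v x (q x) := by
  have hn0 : 0 ≤ ∑ x ∈ s, n x := sum_nonneg fun x _ => hn x
  obtain ⟨q, hq0, hqn, hqw, hopt⟩ := exists_bestResponse_of_sum_eq (s := s) hv
    (exists_ge_sum_eq (w := min 1 (∑ x ∈ s, n x)) hn (by simp [hn0]) (min_le_right _ _))
  refine ⟨q, hq0, hqn, hqw, fun p hp0 hpn hp1 => ?_⟩
  obtain ⟨p', hpp', hp'n, hp'w⟩ := exists_ge_sum_eq (w := min 1 (∑ x ∈ s, n x)) hpn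
    (le_min hp1 (sum_le_sum fun x _ => hpn x)) (min_le_right _ _)
  exact (sum_le_sum fun x hx => mul_le_mul_of_nonneg_right (hpp' x)
    (hv0 x hx _ (hq0 x) (hqn x))).trans (hopt p' (hp0.trans hpp') hp'n hp'w)

lemma exists_roundOptimal_prefix {M k : ℕ} (hk : 1 ≤ k) {f C : ℕ → ℝ} (hf : BoxDist M f)
    (hC : Policy k C) (t : ℕ) :
    ∃ A : ℕ → ℕ → ℝ, (∀ x s, 0 ≤ A x s) ∧ (∀ x ∈ Icc 1 M, 0 ≤ Nbar A x t) ∧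
      (∀ s ≤ t, ∑ x ∈ Icc 1 M, Nbar A x s = ((M - s : ℕ) : ℝ)) ∧
      ∀ s < t, RoundOptimal M k C f A s := by
  induction t with
  | zero =>
    refine ⟨fun _ _ => 0, fun _ _ => le_rfl, fun x _ => by simp [Nbar_zero], fun s hs => ?_, ?_⟩
    · obtain rfl : s = 0 := by lia
      simp [Nbar_zero]
    · simp
  | succ t ih =>
    obtain ⟨A, hA0, hAN, hAsum, hAopt⟩ := ih
    let n : ℕ → ℝ := fun x => if x ∈ Icc 1 M then Nbar A x t else 0
    have hn : ∀ x ∈ Icc 1 M, n x = Nbar A x t := fun x hx => if_pos hx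
    have hn0 : 0 ≤ n := fun x => by
      simp only [n]
      split_ifs with hx
      exacts [hAN x hx, le_rfl]
    obtain ⟨q, hq0, hqn, hqw, hq⟩ := exists_bestResponse (s := Icc 1 M) hn0
      (v := fun x => roundValue k C (f x) (n x)) (fun x => continuous_roundValue k C (f x) (n x))
      (fun x hx u hu hun => roundValue_nonneg hk hC (hf.1 x hx).le hu hun)
    let B : ℕ → ℕ → ℝ := fun x s => if s ≤ t then A x s else q x
    have hBA : ∀ x, ∀ s ≤ t, B x s = A x s := fun x s hs => if_pos hs
    have hBt : ∀ x, B x (t + 1) = q x := fun x => if_neg (by lia)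
    have hNB : ∀ x, ∀ s ≤ t, Nbar B x s = Nbar A x s := fun x s hs =>
      Nbar_congr fun r hr => hBA x r ((mem_Icc.mp hr).2.trans hs)
    refine ⟨B, fun x s => ?_, fun x hx => ?_, fun s hs => ?_, fun s hs => ?_⟩
    · simp only [B]
      split_ifs
      exacts [hA0 x s, hq0 x]
    · rw [Nbar_succ, hNB x t le_rfl, hBt, ← hn x hx]
      exact sub_nonneg.mpr (hqn x)
    · rcases Nat.lt_succ_iff_lt_or_eq.mp (Nat.lt_succ_of_le hs) with hs | rfl
      · rw [← hAsum s (by lia)]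
        exact sum_congr rfl fun x _ => hNB x s (by lia)
      · simp only [Nbar_succ, sum_sub_distrib, hBt, hNB _ t le_rfl]
        rw [hqw, sum_congr rfl hn, hAsum t le_rfl]
        rcases Nat.lt_or_ge t M with htM | htM
        · obtain ⟨d, rfl⟩ : ∃ d, M = t + 1 + d := ⟨M - (t + 1), by lia⟩
          rw [show t + 1 + d - t = d + 1 by lia, show t + 1 + d - (t + 1) = d by lia]
          rw [min_eq_left] <;> push_cast <;> linarith [(Nat.cast_nonneg d : (0 : ℝ) ≤ d)]
        · simp [Nat.sub_eq_zero_of_le htM, Nat.sub_eq_zero_of_le (htM.trans (Nat.le_succ t))]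
    · rcases Nat.lt_succ_iff_lt_or_eq.mp hs with hs | rfl
      · intro p hp0 hpn hp1
        have hval : ∀ x, val k C f B x (s + 1) = val k C f A x (s + 1) := fun x =>
          val_congr (by lia) fun r hr => hBA x r ((mem_Icc.mp hr).2.trans hs)
        simp only [hval, hBA _ (s + 1) hs]
        exact hAopt s hs p hp0 (fun x hx => hNB x s hs.le ▸ hpn x hx) hp1
      · intro p hp0 hpn hp1
        have hval : ∀ x ∈ Icc 1 M, val k C f B x (s + 1) = roundValue k C (f x) (n x) (q x) :=
          fun x hx => by rw [val_succ hk, hBt, hNB x s le_rfl, hn x hx]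
        let p' : ℕ → ℝ := fun x => if x ∈ Icc 1 M then p x else 0
        have hp' : ∀ x ∈ Icc 1 M, p' x = p x := fun x hx => if_pos hx
        have key := hq p' (fun x => by simp only [p']; split_ifs; exacts [hp0 x, le_rfl])
          (fun x => by
            simp only [p', n]
            split_ifs with hx
            exacts [hNB x s le_rfl ▸ hpn x hx, le_rfl])
          (by rwa [sum_congr rfl hp'])
        rw [sum_congr rfl fun x hx => by rw [hval x hx, ← hp' x hx]]
        refine key.trans_eq (sum_congr rfl fun x hx => ?_)
        rw [hval x hx, hBt]

lemma exists_sGreedy {M k : ℕ} (T : ℕ) (hk : 1 ≤ k) {f C : ℕ → ℝ} (hf : BoxDist M f)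
    (hC : Policy k C) :
    ∃ A : ℕ → ℕ → ℝ, Substochastic M T A ∧ NonRedundant M T A ∧ SGreedy M T k C f A := by
  obtain ⟨A, hA0, hAN, hAsum, hAopt⟩ := exists_roundOptimal_prefix hk hf hC T
  have hcol : ∀ s < T, ∑ x ∈ Icc 1 M, A x (s + 1) = ((M - s : ℕ) : ℝ) - ((M - (s + 1) : ℕ) : ℝ) := by
    intro s hs
    rw [← hAsum s hs.le, ← hAsum (s + 1) hs, ← sum_sub_distrib]
    exact sum_congr rfl fun x _ => by rw [Nbar_succ]; ring
  refine ⟨A, ⟨hA0, fun x hx => sub_nonneg.mp (hAN x hx), fun t ht => ?_⟩, fun t ht htM => ?_,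
    sGreedy_of_roundOptimal hAopt⟩
  · obtain ⟨ht1, htT⟩ := mem_Icc.mp ht
    obtain ⟨t, rfl⟩ : ∃ s, t = s + 1 := ⟨t - 1, by lia⟩
    rw [hcol t htT, sub_le_iff_le_add']
    exact_mod_cast (by lia : M - t ≤ M - (t + 1) + 1)
  · obtain ⟨t, rfl⟩ : ∃ s, t = s + 1 := ⟨t - 1, by lia⟩
    rw [hcol t (by lia), sub_eq_iff_eq_add']
    exact_mod_cast (by lia : M - t = M - (t + 1) + 1)

lemma SGreedy.unique {M T k : ℕ} (hk : 1 ≤ k) {f C : ℕ → ℝ} (hf : BoxDist M f) (hC : Policy k C)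
    {A A' : ℕ → ℕ → ℝ} (hA : Substochastic M T A) (hg : SGreedy M T k C f A)
    (hA' : Substochastic M T A') (hg' : SGreedy M T k C f A') :
    ∀ x ∈ Icc 1 M, ∀ t ∈ Icc 1 T, A x t = A' x t := by
  suffices h : ∀ t, 1 ≤ t → t ≤ T → ∀ x ∈ Icc 1 M, A x t = A' x t from
    fun x hx t ht => h t (mem_Icc.mp ht).1 (mem_Icc.mp ht).2 x hx
  intro t
  induction t using Nat.strong_induction_on with
  | _ t ih =>
  intro ht1 htT
  obtain ⟨t, rfl⟩ : ∃ s, t = s + 1 := ⟨t - 1, by lia⟩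
  have hN : ∀ x ∈ Icc 1 M, Nbar A x t = Nbar A' x t := fun x hx => Nbar_congr fun s hs => by
    obtain ⟨hs1, hst⟩ := mem_Icc.mp hs
    exact ih s (by lia) hs1 (by lia) x hx
  have hle : ∀ {D : ℕ → ℕ → ℝ}, Substochastic M T D → ∀ x ∈ Icc 1 M, D x (t + 1) ≤ Nbar D x t :=
    fun hD x hx => sub_nonneg.mp (Nbar_succ _ x t ▸ hD.Nbar_nonneg hx htT)
  have h := hg.roundOptimal hA htT (fun x => A' x (t + 1)) (fun x => hA'.1 x _)
    (fun x hx => hN x hx ▸ hle hA' x hx) (hA'.2.2 _ (by simp [htT]))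
  have h' := hg'.roundOptimal hA' htT (fun x => A x (t + 1)) (fun x => hA.1 x _)
    (fun x hx => hN x hx ▸ hle hA x hx) (hA.2.2 _ (by simp [htT]))
  simp only [val_succ hk] at h h'
  refine eq_of_mutual_bestResponse (n := fun x => Nbar A x t)
    (v := fun x => roundValue k C (f x) (Nbar A x t))
    (fun x hx a b ha hab hb => roundValue_strictAnti hC (hf.1 x hx) ha hab hb)
    (fun x hx => ⟨hA.1 x _, hle hA x hx⟩) (fun x hx => ⟨hA'.1 x _, hN x hx ▸ hle hA' x hx⟩) h ?_
  calc _ = _ := sum_congr rfl fun x hx => by rw [hN x hx]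
    _ ≤ _ := h'
    _ = _ := sum_congr rfl fun x hx => by rw [hN x hx]

/-- for every congestion policy there exists a doubly-substochastic matrix that
is non-redundant and sgreedy, and any two such matrices are equal (on the `M × T` grid). -/
theorem sgreedy_exists_unique
    (M T k : ℕ) (hM : 1 ≤ M) (hT : 1 ≤ T) (hk : 2 ≤ k)
    (f C : ℕ → ℝ) (hf : BoxDist M f) (hC : Policy k C) :
    (∃ A : ℕ → ℕ → ℝ, Substochastic M T A ∧ NonRedundant M T A ∧ SGreedy M T k C f A) ∧
    (∀ A A' : ℕ → ℕ → ℝ,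
      Substochastic M T A → NonRedundant M T A → SGreedy M T k C f A →
      Substochastic M T A' → NonRedundant M T A' → SGreedy M T k C f A' →
      ∀ x ∈ Icc 1 M, ∀ t ∈ Icc 1 T, A x t = A' x t) := by
  exact ⟨exists_sGreedy T (by lia) hf hC,
    fun A A' hA _ hg hA' _ hg' => SGreedy.unique (by lia) hf hC hA hg hA' hg'⟩
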